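/- There is no uniquely C_6-saturated graph with at least 6 vertices. -/

import Mathlib

open SimpleGraph

/-- `G` has a cycle on `t` vertices (a cycle of length `t`). -/
def HasCycleOn {V : Type*} (G : SimpleGraph V) (t : ℕ) : Prop :=
  ∃ (v : V) (w : G.Walk v v), w.IsCycle ∧ w.length = t

/-- `c` is the edge set of some cycle on `t` vertices in `G`. -/
def IsCtEdgeSet {V : Type*} (G : SimpleGraph V) (t : ℕ) (c : Set (Sym2 V)) : Prop :=
  ∃ (v : V) (w : G.Walk v v), w.IsCycle ∧ w.length = t ∧ {e | e ∈ w.edges} = c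

/-- `G` is uniquely `C_t`-saturated: it has no cycle on `t` vertices, and adding any
edge of the complement creates exactly one cycle on `t` vertices. -/
def UniquelyCSat {V : Type*} (G : SimpleGraph V) (t : ℕ) : Prop :=
  ¬ HasCycleOn G t ∧
    ∀ x y : V, x ≠ y → ¬ G.Adj x y →
      ∃! c : Set (Sym2 V), IsCtEdgeSet (G ⊔ fromEdgeSet {s(x, y)}) t c

namespace SimpleGraph

variable {V : Type*} {G : SimpleGraph V}

/-- The vertices `x, a, b, c, d, y` form, in this order, a path on six vertices in `G`. -/
def IsSixPath (G : SimpleGraph V) (x a b c d y : V) : Prop :=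
  [x, a, b, c, d, y].Nodup ∧ [x, a, b, c, d, y].IsChain G.Adj

theorem exists_isCycle_of_isSixPath {x a b c d y : V} (h : G.IsSixPath x a b c d y)
    (hyx : G.Adj y x) :
    ∃ w : G.Walk y y, w.IsCycle ∧ w.length = 6 ∧
      w.edges = [s(y, x), s(x, a), s(a, b), s(b, c), s(c, d), s(d, y)] := by
  obtain ⟨hn, hc⟩ := h
  simp only [List.isChain_cons_cons, List.isChain_singleton, and_true] at hc
  obtain ⟨h1, h2, h3, h4, h5⟩ := hc
  refine ⟨.cons hyx (.cons h1 (.cons h2 (.cons h3 (.cons h4 (.cons h5 .nil))))), ?_, rfl, rfl⟩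
  simp only [Walk.cons_isCycle_iff, Walk.cons_isPath_iff, Walk.support_cons, Walk.support_nil,
    Walk.edges_cons, Walk.edges_nil]
  simp at hn ⊢
  grind

theorem IsSixPath.mono {H : SimpleGraph V} (hGH : G ≤ H) {x a b c d y : V}
    (h : G.IsSixPath x a b c d y) : H.IsSixPath x a b c d y :=
  ⟨h.1, h.2.imp fun _ _ hab => hGH hab⟩

theorem IsSixPath.not_adj (hG : ¬ HasCycleOn G 6) {x a b c d y : V}
    (h : G.IsSixPath x a b c d y) : ¬ G.Adj x y := fun hxy =>
  have ⟨w, hw, hl, _⟩ := exists_isCycle_of_isSixPath h hxy.symm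
  hG ⟨y, w, hw, hl⟩

theorem IsSixPath.eq_of_uniquelyCSat (hG : UniquelyCSat G 6) {x a b c d y a' b' c' d' : V}
    (h : G.IsSixPath x a b c d y) (h' : G.IsSixPath x a' b' c' d' y) :
    a = a' ∧ b = b' ∧ c = c' ∧ d = d' := by
  have hxy : ¬ G.Adj x y := h.not_adj hG.1
  have hne : x ≠ y := by
    rintro rfl
    simpa using h.1
  have hadj : (G ⊔ fromEdgeSet {s(x, y)}).Adj y x := by
    simp [hne.symm, Sym2.eq_swap]
  obtain ⟨w, hw, hl, he⟩ := exists_isCycle_of_isSixPath (h.mono le_sup_left) hadj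
  obtain ⟨w', hw', hl', he'⟩ := exists_isCycle_of_isSixPath (h'.mono le_sup_left) hadj
  have heq := (hG.2 x y hne hxy).unique ⟨y, w, hw, hl, rfl⟩ ⟨y, w', hw', hl', rfl⟩
  rw [he, he'] at heq
  have hn := h.1
  have hn' := h'.1
  have e1 : s(x, a) ∈ {e | e ∈ [s(y, x), s(x, a'), s(a', b'), s(b', c'), s(c', d'), s(d', y)]} :=
    heq ▸ by simp
  have e2 : s(a, b) ∈ {e | e ∈ [s(y, x), s(x, a'), s(a', b'), s(b', c'), s(c', d'), s(d', y)]} :=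
    heq ▸ by simp
  have e3 : s(b, c) ∈ {e | e ∈ [s(y, x), s(x, a'), s(a', b'), s(b', c'), s(c', d'), s(d', y)]} :=
    heq ▸ by simp
  have e4 : s(c, d) ∈ {e | e ∈ [s(y, x), s(x, a'), s(a', b'), s(b', c'), s(c', d'), s(d', y)]} :=
    heq ▸ by simp
  simp only [Set.mem_ofPred_eq, List.mem_cons, List.not_mem_nil, or_false, Sym2.eq_iff]
    at e1 e2 e3 e4
  simp only [List.nodup_cons, List.mem_cons, List.not_mem_nil, or_false, not_or] at hn hn'
  have ha : a = a' := by grind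
  subst ha
  have hb : b = b' := by grind
  subst hb
  have hc : c = c' := by grind
  subst hc
  have hd : d = d' := by grind
  exact ⟨rfl, rfl, rfl, hd⟩

theorem exists_isSixPath_of_cycle {x y v₀ v₁ v₂ v₃ v₄ v₅ : V}
    (hn : [v₀, v₁, v₂, v₃, v₄, v₅].Nodup)
    (hc : [v₀, v₁, v₂, v₃, v₄, v₅, v₀].IsChain (G ⊔ fromEdgeSet {s(x, y)}).Adj)
    (h01 : ¬ G.Adj v₀ v₁) : ∃ a b c d, G.IsSixPath x a b c d y := by
  simp only [List.isChain_cons_cons, List.isChain_singleton, and_true, sup_adj, fromEdgeSet_adj,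
    Set.mem_singleton_iff, Sym2.eq_iff] at hc
  simp only [List.nodup_cons, List.mem_cons, List.not_mem_nil, or_false, not_or] at hn
  obtain ⟨h1, h2, h3, h4, h5, h6⟩ := hc
  rcases (h1.resolve_left h01).1 with ⟨rfl, rfl⟩ | ⟨rfl, rfl⟩
  · refine ⟨v₅, v₄, v₃, v₂, ?_, ?_⟩
    · grind
    · simp only [List.isChain_cons_cons, List.isChain_singleton, and_true]
      grind [G.adj_comm]
  · refine ⟨v₂, v₃, v₄, v₅, ?_, ?_⟩
    · grind
    · simp only [List.isChain_cons_cons, List.isChain_singleton, and_true]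
      grind

theorem exists_isSixPath_of_uniquelyCSat (hG : UniquelyCSat G 6) {x y : V} (hne : x ≠ y)
    (hxy : ¬ G.Adj x y) : ∃ a b c d, G.IsSixPath x a b c d y := by
  obtain ⟨_, ⟨v, w, hw, hl, _⟩, _⟩ := hG.2 x y hne hxy
  obtain _ | ⟨h1, w⟩ := w
  · simp at hl
  obtain _ | ⟨h2, w⟩ := w
  · simp at hl
  obtain _ | ⟨h3, w⟩ := w
  · simp at hl
  obtain _ | ⟨h4, w⟩ := w
  · simp at hl
  obtain _ | ⟨h5, w⟩ := w
  · simp at hl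
  obtain _ | ⟨h6, w⟩ := w
  · simp at hl
  obtain _ | ⟨h7, w⟩ := w
  · rename_i v₁ v₂ v₃ v₄ v₅ _
    have hn : [v₁, v₂, v₃, v₄, v₅, v].Nodup := by simpa using hw.support_nodup
    by_contra hno
    have key {u₀ u₁ u₂ u₃ u₄ u₅ : V}
        (h : [u₀, u₁, u₂, u₃, u₄, u₅].Nodup ∧
          [u₀, u₁, u₂, u₃, u₄, u₅, u₀].IsChain (G ⊔ fromEdgeSet {s(x, y)}).Adj) :
        G.Adj u₀ u₁ ∧ [u₁, u₂, u₃, u₄, u₅, u₀].Nodup ∧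
          [u₁, u₂, u₃, u₄, u₅, u₀, u₁].IsChain (G ⊔ fromEdgeSet {s(x, y)}).Adj := by
      refine ⟨not_not.1 fun h' => hno (exists_isSixPath_of_cycle h.1 h.2 h'), ?_, ?_⟩
      · exact (List.nodup_rotate (n := 1)).2 h.1
      · have := h.2
        simp only [List.isChain_cons_cons, List.isChain_singleton, and_true] at this ⊢
        tauto
    have k₁ := key ⟨hn, by
      simp only [List.isChain_cons_cons, List.isChain_singleton, and_true]
      exact ⟨h2, h3, h4, h5, h6, h1⟩⟩
    have k₂ := key k₁.2
    have k₃ := key k₂.2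
    have k₄ := key k₃.2
    have k₅ := key k₄.2
    have k₆ := key k₅.2
    refine IsSixPath.not_adj hG.1 ⟨hn, ?_⟩ k₆.1.symm
    simp [k₁.1, k₂.1, k₃.1, k₄.1, k₅.1]
  · simp at hl

/-- A graph on at least six vertices without a cycle on six vertices is not complete. -/
theorem exists_not_adj_of_not_hasCycleOn [Fintype V] (hn : 6 ≤ Fintype.card V)
    (hG : ¬ HasCycleOn G 6) : ∃ x y : V, x ≠ y ∧ ¬ G.Adj x y := by
  by_contra! hall
  obtain ⟨e⟩ : Nonempty (Fin 6 ↪ V) := Function.Embedding.nonempty_of_card_le (by simpa using hn)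
  have hadj (i j : Fin 6) (h : i ≠ j) : G.Adj (e i) (e j) := hall _ _ (e.injective.ne h)
  refine IsSixPath.not_adj hG (x := e 0) (a := e 1) (b := e 2) (c := e 3) (d := e 4) (y := e 5)
    ⟨?_, ?_⟩ (hadj _ _ (by decide))
  · exact List.Nodup.map (f := e) e.injective (l := [0, 1, 2, 3, 4, 5]) (by decide)
  · simp only [List.isChain_cons_cons, List.isChain_singleton, and_true]
    refine ⟨?_, ?_, ?_, ?_, ?_⟩ <;> exact hadj _ _ (by decide)

end SimpleGraph

namespace SixPathSearch

/-- The neighbours of `v` in the graph on `ℕ` with edge list `E`. -/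
def nbrs (v : ℕ) (E : List (ℕ × ℕ)) : List ℕ :=
  E.rec [] fun e _ ih => (e.1.beq v).rec ((e.2.beq v).rec ih (e.1 :: ih)) (e.2 :: ih)

/-- Boolean membership in a list of natural numbers. -/
def mem (v : ℕ) (L : List ℕ) : Bool :=
  L.rec false fun w _ ih => (v.beq w).rec ih true

/-- Prepend to `acc` all ways to extend the path `p` (listed from its last vertex `v`) by `n`
further vertices. -/
def paths (N : ℕ → List ℕ) (n : ℕ) : ℕ → List ℕ → List (List ℕ) → List (List ℕ) :=
  n.rec (fun _ p acc => p :: acc) fun _ ih v p acc =>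
    (N v).rec acc fun w _ r => (mem w p).rec (ih w (w :: p) r) r

/-- A list of paths with a common start contains a path whose ends are adjacent, or two
distinct paths with the same end. -/
def conflict (N : List ℕ) : List (List ℕ) → Bool
  | [] => false
  | p :: L => mem (p.headD 0) N || L.any (fun q => (p.headD 0).beq (q.headD 0) && p != q) ||
      conflict N L

/-- The edge list `E` is incompatible with unique saturation. -/
def bad (E : List (ℕ × ℕ)) : Bool :=
  (List.range 6).any fun v => conflict (nbrs v E) (paths (fun v => nbrs v E) 5 v [v] [])

/-- Add an edge to an edge list, unless it is already present. -/
def addEdge (u v : ℕ) (E : List (ℕ × ℕ)) : List (ℕ × ℕ) :=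
  bif mem v (nbrs u E) then E else (u, v) :: E

/-- `cont` accepts every way, not immediately contradictory, of completing the partial path `p`
with last vertex `v` by `n` further vertices and then `t`. -/
def completions (cont : ℕ → List (ℕ × ℕ) → Bool) (t : ℕ) :
    ℕ → ℕ → List ℕ → ℕ → List (ℕ × ℕ) → Bool
  | 0, v, _, k, E => bad (addEdge v t E) || cont k (addEdge v t E)
  | n + 1, v, p, k, E => bad E || (List.range (k + 1)).all fun w =>
      mem w p || w.beq t || completions cont t n w (w :: p) (max k (w + 1)) (addEdge v w E)

/-- Branch successively on the pairs chosen by `strat`. -/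
def search (strat : List (ℕ × ℕ) → ℕ × ℕ) : ℕ → ℕ → List (ℕ × ℕ) → Bool
  | 0, _, _ => false
  | n + 1, k, E =>
    let i := (strat E).1
    let j := (strat E).2
    i.blt j && j.blt k && (bad (addEdge i j E) || search strat n k (addEdge i j E)) &&
      completions (search strat n) j 4 i [i] k E

/-- A choice of branching pairs for which the search, started at a six-vertex path, succeeds. -/
def strategy (E : List (ℕ × ℕ)) : ℕ × ℕ :=
  let adj (u v : ℕ) : Bool := mem v (nbrs u E)
  bif adj 1 3 then (0, 3)
  else bif adj 1 4 then (1, 3)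
  else bif adj 3 8 then (2, 8)
  else bif adj 0 2 && adj 3 5 then (0, 3)
  else bif adj 0 2 then (2, 4)
  else bif adj 0 6 then (0, 2)
  else bif adj 2 6 then (1, 7)
  else (1, 4)

theorem search_eq_true :
    search strategy 3 6 [(0, 1), (1, 2), (2, 3), (3, 4), (4, 5)] = true := by
  decide +kernel

theorem mem_eq_true {v : ℕ} {L : List ℕ} : mem v L = true ↔ v ∈ L := by
  induction L with
  | nil => simp [mem]
  | cons w L ih =>
    rw [List.mem_cons, ← ih, ← Nat.beq_eq]
    change (v.beq w).rec (mem v L) true = true ↔ _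
    cases v.beq w <;> simp

theorem mem_or_mem_of_mem_nbrs {v w : ℕ} {E : List (ℕ × ℕ)} (h : w ∈ nbrs v E) :
    (v, w) ∈ E ∨ (w, v) ∈ E := by
  induction E with
  | nil => simp [nbrs] at h
  | cons e E ih =>
    change w ∈ ((e.1.beq v).rec ((e.2.beq v).rec (nbrs v E) (e.1 :: nbrs v E))
      (e.2 :: nbrs v E) : List ℕ) at h
    obtain ⟨e₁, e₂⟩ := e
    cases h1 : e₁.beq v <;> cases h2 : e₂.beq v <;> simp only [h1, h2] at h <;> grind [Nat.beq_eq]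

theorem of_mem_paths {N : ℕ → List ℕ} {n v : ℕ} {p q : List ℕ} {acc : List (List ℕ)}
    (hn : (v :: p).Nodup) (hc : (v :: p).IsChain fun a b => a ∈ N b)
    (hq : q ∈ paths N n v (v :: p) acc) :
    q ∈ acc ∨ q.Nodup ∧ q.IsChain (fun a b => a ∈ N b) ∧ q.length = n + (p.length + 1) ∧
      q.getLast? = (v :: p).getLast? := by
  induction n generalizing v p acc with
  | zero =>
    obtain rfl | h := List.mem_cons.1 hq
    · exact .inr ⟨hn, hc, by simp, rfl⟩
    · exact .inl h
  | succ n ih =>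
    have key (L : List ℕ) (hL : ∀ w ∈ L, w ∈ N v)
        (hq : q ∈ (L.rec acc fun w _ r =>
          (mem w (v :: p)).rec (paths N n w (w :: v :: p) r) r : List (List ℕ))) :
        q ∈ acc ∨ q.Nodup ∧ q.IsChain (fun a b => a ∈ N b) ∧
          q.length = n + 1 + (p.length + 1) ∧ q.getLast? = (v :: p).getLast? := by
      induction L with
      | nil => exact .inl hq
      | cons w L ihL =>
        have ihL' := ihL fun w hw => hL w (List.mem_cons_of_mem _ hw)
        cases hw : mem w (v :: p) with
        | true =>
          simp only [hw] at hq
          exact ihL' hq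
        | false =>
          simp only [hw] at hq
          have hw' : w ∉ v :: p := fun h => by simp [mem_eq_true.2 h] at hw
          obtain h | ⟨h1, h2, h3, h4⟩ := ih (List.nodup_cons.2 ⟨hw', hn⟩)
            (List.isChain_cons_cons.2 ⟨hL w List.mem_cons_self, hc⟩) hq
          · exact ihL' h
          · refine .inr ⟨h1, h2, ?_, by simpa using h4⟩
            rw [h3, List.length_cons]
            omega
    exact key (N v) (fun _ h => h) hq

theorem exists_of_conflict {N : ℕ → Prop} {M : List ℕ} (hM : ∀ v ∈ M, N v) {L : List (List ℕ)}
    (h : conflict M L = true) :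
    ∃ p ∈ L, N (p.headD 0) ∨ ∃ q ∈ L, p.headD 0 = q.headD 0 ∧ p ≠ q := by
  induction L with
  | nil => simp [conflict] at h
  | cons p L ih =>
    simp only [conflict, Bool.or_eq_true, mem_eq_true, List.any_eq_true, Bool.and_eq_true,
      Nat.beq_eq, bne_iff_ne] at h
    obtain (h | ⟨q, hq, h1, h2⟩) | h := h
    · exact ⟨p, by simp, .inl (hM _ h)⟩
    · exact ⟨p, by simp, .inr ⟨q, by simp [hq], h1, h2⟩⟩
    · obtain ⟨p, hp, h | ⟨q, hq, h⟩⟩ := ih h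
      · exact ⟨p, by simp [hp], .inl h⟩
      · exact ⟨p, by simp [hp], .inr ⟨q, by simp [hq], h⟩⟩

variable {V : Type*} {G : SimpleGraph V}

/-- The map `f` embeds the graph on `{0, …, k - 1}` with edge list `E` into `G`. -/
structure Realizes (G : SimpleGraph V) (f : ℕ → V) (k : ℕ) (E : List (ℕ × ℕ)) : Prop where
  inj : ∀ u v, u < k → v < k → f u = f v → u = v
  adj : ∀ u v, (u, v) ∈ E → u < k ∧ v < k ∧ G.Adj (f u) (f v)

namespace Realizes

variable {f : ℕ → V} {k : ℕ} {E : List (ℕ × ℕ)}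

theorem of_mem_nbrs (hf : Realizes G f k E) {u v : ℕ} (h : v ∈ nbrs u E) :
    u < k ∧ v < k ∧ G.Adj (f u) (f v) := by
  obtain h | h := mem_or_mem_of_mem_nbrs h
  · exact hf.adj _ _ h
  · have := hf.adj _ _ h
    exact ⟨this.2.1, this.1, this.2.2.symm⟩

theorem addEdge (hf : Realizes G f k E) {u v : ℕ} (hu : u < k) (hv : v < k)
    (h : G.Adj (f u) (f v)) : Realizes G f k (addEdge u v E) := by
  unfold SixPathSearch.addEdge
  cases mem v (nbrs u E)
  · refine ⟨hf.inj, fun a b hab => ?_⟩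
    obtain hab | hab := List.mem_cons.1 hab
    · obtain ⟨rfl, rfl⟩ := Prod.mk.inj hab
      exact ⟨hu, hv, h⟩
    · exact hf.adj _ _ hab
  · exact hf

theorem update (hf : Realizes G f k E) {w : V} (hw : ∀ i < k, f i ≠ w) :
    Realizes G (Function.update f k w) (k + 1) E := by
  have hlt {i : ℕ} (hi : i < k) : Function.update f k w i = f i :=
    Function.update_of_ne hi.ne _ _
  refine ⟨fun u v hu hv huv => ?_, fun u v huv => ?_⟩
  · obtain hu' | rfl := (Nat.lt_succ_iff_lt_or_eq.1 hu) <;>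
      obtain hv' | rfl := (Nat.lt_succ_iff_lt_or_eq.1 hv)
    · rw [hlt hu', hlt hv'] at huv
      exact hf.inj _ _ hu' hv' huv
    · rw [hlt hu', Function.update_self] at huv
      exact (hw _ hu' huv).elim
    · rw [hlt hv', Function.update_self] at huv
      exact (hw _ hv' huv.symm).elim
    · rfl
  · obtain ⟨hu, hv, h⟩ := hf.adj _ _ huv
    rw [hlt hu, hlt hv]
    exact ⟨hu.trans (Nat.lt_succ_self _), hv.trans (Nat.lt_succ_self _), h⟩

theorem exists_isSixPath_of_mem_paths (hf : Realizes G f k E) {v : ℕ} {q : List ℕ}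
    (hq : q ∈ paths (fun u => nbrs u E) 5 v [v] []) :
    ∃ a b c d y, q = [y, d, c, b, a, v] ∧ (∀ i ∈ q, i < k) ∧
      G.IsSixPath (f v) (f a) (f b) (f c) (f d) (f y) := by
  obtain h | ⟨hn, hc, hl, hlast⟩ := of_mem_paths (by simp) (by simp) hq
  · simp at h
  match q, hl with
  | [y, d, c, b, a, x], _ =>
    obtain rfl : x = v := by simpa using hlast
    simp only [List.isChain_cons_cons, List.isChain_singleton, and_true] at hc
    obtain ⟨h1, h2, h3, h4, h5⟩ := hc
    have h1 := hf.of_mem_nbrs h1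
    have h2 := hf.of_mem_nbrs h2
    have h3 := hf.of_mem_nbrs h3
    have h4 := hf.of_mem_nbrs h4
    have h5 := hf.of_mem_nbrs h5
    have hlt : ∀ i ∈ [y, d, c, b, a, x], i < k := by
      simp [h1.2.1, h2.2.1, h3.2.1, h4.2.1, h5.2.1, h5.1]
    refine ⟨a, b, c, d, y, rfl, hlt, ?_, ?_⟩
    · have := (List.nodup_map_iff_inj_on hn).2
        fun u hu v hv => hf.inj u v (hlt u hu) (hlt v hv)
      simpa using List.nodup_reverse.2 this
    · simp [h1, h2, h3, h4, h5]

theorem bad_eq_false (hG : UniquelyCSat G 6) (hf : Realizes G f k E) : bad E = false := by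
  by_contra h
  simp only [bad, Bool.not_eq_false, List.any_eq_true] at h
  obtain ⟨v, -, h⟩ := h
  obtain ⟨p, hp, h⟩ := exists_of_conflict (N := fun w => G.Adj (f v) (f w))
    (fun w hw => (hf.of_mem_nbrs hw).2.2) h
  obtain ⟨a, b, c, d, y, rfl, hlt, hpath⟩ := hf.exists_isSixPath_of_mem_paths hp
  obtain h | ⟨q, hq, hy, hne⟩ := h
  · exact hpath.not_adj hG.1 h
  · obtain ⟨a', b', c', d', y', rfl, hlt', hpath'⟩ := hf.exists_isSixPath_of_mem_paths hq
    obtain rfl : y = y' := hy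
    obtain ⟨ha, hb, hc, hd⟩ := hpath.eq_of_uniquelyCSat hG hpath'
    simp only [List.forall_mem_cons] at hlt hlt'
    refine hne ?_
    rw [hf.inj a a' (by tauto) (by tauto) ha, hf.inj b b' (by tauto) (by tauto) hb,
      hf.inj c c' (by tauto) (by tauto) hc, hf.inj d d' (by tauto) (by tauto) hd]

theorem completions_eq_false (hG : UniquelyCSat G 6) {cont : ℕ → List (ℕ × ℕ) → Bool}
    (hcont : ∀ f k E, Realizes G f k E → cont k E = false) (hf : Realizes G f k E)
    {t v : ℕ} {p : List ℕ} (ht : t < k) (hp : ∀ u ∈ p, u < k) (hv : v < k) {ws : List V}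
    (hc : (f v :: (ws ++ [f t])).IsChain G.Adj) (hn : ws.Nodup) (hpw : ∀ u ∈ p, f u ∉ ws)
    (htw : f t ∉ ws) : completions cont t ws.length v p k E = false := by
  induction ws generalizing f k E v p with
  | nil =>
    have := hf.addEdge hv ht (by simpa using hc)
    simp [completions, this.bad_eq_false hG, hcont f k _ this]
  | cons w ws ih =>
    rw [List.cons_append, List.isChain_cons_cons] at hc
    obtain ⟨hvw, hc⟩ := hc
    obtain ⟨hw, hn'⟩ := List.nodup_cons.1 hn
    simp only [List.mem_cons, not_or] at htw hpw
    suffices ∃ i ≤ k, i ∉ p ∧ i ≠ t ∧ completions cont t ws.length i (i :: p) (max k (i + 1))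
        (SixPathSearch.addEdge v i E) = false by
      obtain ⟨i, hi, hip, hit, h⟩ := this
      rw [List.length_cons, completions, hf.bad_eq_false hG, Bool.false_or, List.all_eq_false]
      refine ⟨i, List.mem_range.2 (Nat.lt_succ_of_le hi), ?_⟩
      simpa [h, mem_eq_true] using ⟨hip, hit⟩
    by_cases hex : ∃ i < k, f i = w
    · obtain ⟨i, hi, rfl⟩ := hex
      refine ⟨i, hi.le, fun h => (hpw i h).1 rfl, fun h => htw.1 (by rw [h]), ?_⟩
      rw [max_eq_left hi]
      exact ih (hf.addEdge hv hi hvw) ht (by simpa [hi] using hp) hi hc hn'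
        (by simpa [hw] using fun u hu => (hpw u hu).2) htw.2
    · push Not at hex
      have hlt {i : ℕ} (hi : i < k) : Function.update f k w i = f i :=
        Function.update_of_ne hi.ne _ _
      have hk : Function.update f k w k = w := Function.update_self ..
      refine ⟨k, le_rfl, fun h => (hp k h).false, ht.ne', ?_⟩
      rw [max_eq_right k.le_succ]
      refine ih ((hf.update hex).addEdge (hv.trans k.lt_succ_self) k.lt_succ_self ?_)
        (ht.trans k.lt_succ_self) ?_ k.lt_succ_self ?_ hn' ?_ ?_
      · rwa [hlt hv, hk]
      · simpa using fun u hu => (hp u hu).trans k.lt_succ_self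
      · rwa [hlt ht, hk]
      · rw [List.forall_mem_cons, hk]
        exact ⟨hw, fun u hu => by rw [hlt (hp u hu)]; exact (hpw u hu).2⟩
      · rw [hlt ht]
        exact htw.2

theorem search_eq_false (hG : UniquelyCSat G 6) {strat : List (ℕ × ℕ) → ℕ × ℕ} (n : ℕ)
    (hf : Realizes G f k E) : search strat n k E = false := by
  induction n generalizing f k E with
  | zero => rfl
  | succ n ih =>
    by_contra h
    simp only [search, Bool.not_eq_false, Bool.and_eq_true, Nat.blt_eq] at h
    obtain ⟨⟨⟨hij, hj⟩, hadj⟩, hpath⟩ := h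
    have hi := hij.trans hj
    by_cases hA : G.Adj (f (strat E).1) (f (strat E).2)
    · have := hf.addEdge hi hj hA
      simp [this.bad_eq_false hG, ih this] at hadj
    · obtain ⟨a, b, c, d, hn, hc⟩ := exists_isSixPath_of_uniquelyCSat hG
        (fun h => hij.ne (hf.inj _ _ hi hj h)) hA
      have := hf.completions_eq_false hG (fun f k E hf => ih hf) (p := [(strat E).1])
        (ws := [a, b, c, d]) hj (by simpa using hi) hi hc (by grind) (by grind) (by grind)
      exact Bool.false_ne_true (this.symm.trans hpath)

end Realizes

end SixPathSearch

/-- There is no uniquely `C_6`-saturated graph with at least 6 vertices. -/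
theorem stmt_12 {V : Type*} [Fintype V] (G : SimpleGraph V)
    (hn : 6 ≤ Fintype.card V) : ¬ UniquelyCSat G 6 := by
  intro hG
  obtain ⟨x, y, hne, hxy⟩ := exists_not_adj_of_not_hasCycleOn hn hG.1
  obtain ⟨a, b, c, d, hnodup, hc⟩ := exists_isSixPath_of_uniquelyCSat hG hne hxy
  have hf : SixPathSearch.Realizes G (fun i => [x, a, b, c, d, y].getD i x) 6
      [(0, 1), (1, 2), (2, 3), (3, 4), (4, 5)] := by
    refine ⟨fun u v hu hv huv => ?_, ?_⟩
    · rw [List.getD_eq_getElem _ _ hu, List.getD_eq_getElem _ _ hv] at huv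
      exact hnodup.getElem_inj_iff.1 huv
    · simp only [List.isChain_cons_cons, List.isChain_singleton, and_true] at hc
      simp only [List.mem_cons, List.not_mem_nil, or_false, Prod.mk.injEq]
      rintro u v (⟨rfl, rfl⟩ | ⟨rfl, rfl⟩ | ⟨rfl, rfl⟩ | ⟨rfl, rfl⟩ | ⟨rfl, rfl⟩) <;> simp [hc]
  exact Bool.false_ne_true ((hf.search_eq_false hG 3).symm.trans SixPathSearch.search_eq_true)
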